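/- Let Γ be a finite simplicial graph. The right-angled Artin group A(Γ) splits nontrivially over an abelian subgroup (i.e., A(Γ) admits an action without inversions on a simplicial tree with no global fixed vertex and with all edge stabilizers abelian) if and only if at least one of the following holds: (1) Γ is disconnected; (2) Γ is a complete graph; (3) Γ contains a separating clique. -/

import Mathlib

/-- The relators of the right-angled Artin group of a graph `Γ`: one commutator
relator for each pair of adjacent vertices. -/
def raagRels {V : Type} (Γ : SimpleGraph V) : Set (FreeGroup V) :=
  {r | ∃ u v : V, Γ.Adj u v ∧
    r = FreeGroup.of u * FreeGroup.of v * (FreeGroup.of u)⁻¹ * (FreeGroup.of v)⁻¹}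

/-- The right-angled Artin group `A(Γ)` of a graph `Γ`. -/
abbrev RAAG {V : Type} (Γ : SimpleGraph V) : Type := PresentedGroup (raagRels Γ)

/-- The generator of `RAAG Γ` corresponding to a vertex `v`. -/
def RAAG.gen {V : Type} (Γ : SimpleGraph V) (v : V) : RAAG Γ := PresentedGroup.of v

section Action

variable {G W : Type} [Group G]

/-- The homomorphism `φ : G →* Equiv.Perm W` acts by automorphisms of the graph `T`. -/
def PreservesAdj (T : SimpleGraph W) (φ : G →* Equiv.Perm W) : Prop :=
  ∀ (g : G) (u v : W), T.Adj u v → T.Adj (φ g u) (φ g v)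

/-- The action `φ` on the graph `T` is without edge inversions. -/
def NoInversions (T : SimpleGraph W) (φ : G →* Equiv.Perm W) : Prop :=
  ∀ (g : G) (u v : W), T.Adj u v → ¬(φ g u = v ∧ φ g v = u)

/-- All edge stabilizers of the action `φ` on the graph `T` are abelian: any two
elements fixing both endpoints of an edge commute. -/
def AbelianEdgeStabilizers (T : SimpleGraph W) (φ : G →* Equiv.Perm W) : Prop :=
  ∀ u v : W, T.Adj u v → ∀ g h : G,
    φ g u = u → φ g v = v → φ h u = u → φ h v = v → g * h = h * g

/-- An element `g` is elliptic for the action `φ` if it fixes some vertex. -/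
def Elliptic (φ : G →* Equiv.Perm W) (g : G) : Prop := ∃ w : W, φ g w = w

/-- The action `φ` has a global fixed vertex. -/
def HasGlobalFixedVertex (φ : G →* Equiv.Perm W) : Prop := ∃ w : W, ∀ g : G, φ g w = w

end Action

/-- `K` is a separating clique of `Γ`: a clique whose removal disconnects `Γ`. -/
def SeparatingClique {V : Type} (Γ : SimpleGraph V) (K : Set V) : Prop :=
  Γ.IsClique K ∧ ∃ x y : ↥(Kᶜ), ¬ (Γ.induce Kᶜ).Reachable x y

/-- The homomorphism out of a right-angled Artin group determined by images of the generators
that commute along edges. -/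
def RAAG.lift {V : Type} {Γ : SimpleGraph V} {G : Type*} [Group G] (f : V → G)
    (hf : ∀ u v, Γ.Adj u v → Commute (f u) (f v)) : RAAG Γ →* G :=
  PresentedGroup.toGroup (f := f) (by
    rintro r ⟨u, v, huv, rfl⟩
    simp only [map_mul, map_inv, FreeGroup.lift_apply_of]
    rw [(hf u v huv).eq]
    group)

@[simp]
theorem RAAG.lift_gen {V : Type} {Γ : SimpleGraph V} {G : Type*} [Group G] (f : V → G)
    (hf : ∀ u v, Γ.Adj u v → Commute (f u) (f v)) (v : V) :
    RAAG.lift f hf (RAAG.gen Γ v) = f v :=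
  PresentedGroup.toGroup.of _

theorem RAAG.commute_gen {V : Type} {Γ : SimpleGraph V} {u v : V} (h : Γ.Adj u v) :
    Commute (RAAG.gen Γ u) (RAAG.gen Γ v) := by
  have : PresentedGroup.mk (raagRels Γ) (FreeGroup.of u * FreeGroup.of v *
      (FreeGroup.of u)⁻¹ * (FreeGroup.of v)⁻¹) = 1 :=
    PresentedGroup.one_of_mem ⟨u, v, h, rfl⟩
  simp only [map_mul, map_inv] at this
  rw [mul_inv_eq_one, mul_inv_eq_iff_eq_mul] at this
  exact this

theorem RAAG.closure_range_gen {V : Type} (Γ : SimpleGraph V) :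
    Subgroup.closure (Set.range (RAAG.gen Γ)) = ⊤ :=
  PresentedGroup.closure_range_of _

theorem RAAG.gen_notMem_closure {V : Type} (Γ : SimpleGraph V) {K : Set V} {v : V}
    (hv : v ∉ K) : RAAG.gen Γ v ∉ Subgroup.closure (RAAG.gen Γ '' K) := by
  classical
  let ψ : RAAG Γ →* Multiplicative ℤ :=
    RAAG.lift (fun u => if u = v then Multiplicative.ofAdd 1 else 1) fun _ _ _ => Commute.all _ _
  intro h
  have hle : Subgroup.closure (RAAG.gen Γ '' K) ≤ ψ.ker := by
    rw [Subgroup.closure_le]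
    rintro _ ⟨u, hu, rfl⟩
    have : u ≠ v := fun e => hv (e ▸ hu)
    simp [ψ, MonoidHom.mem_ker, this]
  have := hle h
  simp [ψ, MonoidHom.mem_ker] at this

theorem RAAG.commute_of_mem_closure {V : Type} (Γ : SimpleGraph V) {K : Set V}
    (hK : Γ.IsClique K) {g h : RAAG Γ} (hg : g ∈ Subgroup.closure (RAAG.gen Γ '' K))
    (hh : h ∈ Subgroup.closure (RAAG.gen Γ '' K)) : g * h = h * g := by
  have := Subgroup.isMulCommutative_closure (k := RAAG.gen Γ '' K) (by
    rintro _ ⟨u, hu, rfl⟩ _ ⟨v, hv, rfl⟩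
    by_cases e : u = v
    · rw [e]
    · exact (RAAG.commute_gen (hK hu hv e)).eq)
  exact setLike_mul_comm hg hh

/-- A graph is acyclic if the endpoints of each edge are separated by a function that is constant
along every other edge. -/
theorem SimpleGraph.isAcyclic_of_separating {W : Type*} {T : SimpleGraph W}
    (h : ∀ u v, T.Adj u v → ∃ c : W → ℤ, c u ≠ c v ∧
      ∀ a b, T.Adj a b → s(a, b) ≠ s(u, v) → c a = c b) : T.IsAcyclic := by
  rw [SimpleGraph.isAcyclic_iff_forall_adj_isBridge]
  intro u v huv
  obtain ⟨c, hc, hconst⟩ := h u v huv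
  rw [SimpleGraph.isBridge_iff]
  refine fun hr => hc ?_
  obtain ⟨p⟩ := hr
  have : ∀ {a b : W}, (T.deleteEdges {s(u, v)}).Walk a b → c a = c b := by
    intro a b p
    induction p with
    | nil => rfl
    | cons hadj _ ih =>
      rw [SimpleGraph.deleteEdges_adj] at hadj
      rw [← ih]
      exact hconst _ _ hadj.1 hadj.2
  exact this p

section CosetFunctions

variable {G : Type} [Group G] (H : Subgroup G)

/-- The action of `G` on the integer-valued functions on `G ⧸ H` by translation. -/
def cosetShift : G →* Equiv.Perm (G ⧸ H → ℤ) :=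
  @MulAction.toPermHom G (G ⧸ H → ℤ) _ arrowAction

variable {H}

theorem cosetShift_apply (g : G) (f : G ⧸ H → ℤ) (x : G ⧸ H) :
    cosetShift H g f x = f (g⁻¹ • x) := rfl

variable (H) in
open Classical in
/-- The indicator function of the trivial coset. -/
noncomputable def baseIndicator : G ⧸ H → ℤ := Pi.single ((1 : G) : G ⧸ H) 1

theorem cosetShift_baseIndicator_apply_self (g : G) :
    cosetShift H g (baseIndicator H) (g : G ⧸ H) = 1 := by
  rw [cosetShift_apply, MulAction.Quotient.smul_coe, smul_eq_mul, inv_mul_cancel]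
  simp [baseIndicator]

theorem cosetShift_baseIndicator_apply_of_ne {g : G} {x : G ⧸ H} (hx : x ≠ (g : G ⧸ H)) :
    cosetShift H g (baseIndicator H) x = 0 := by
  classical
  rw [cosetShift_apply, baseIndicator, Pi.single_eq_of_ne]
  intro h
  apply hx
  rw [inv_smul_eq_iff] at h
  rw [h, MulAction.Quotient.smul_coe, smul_eq_mul, mul_one]

theorem cosetShift_baseIndicator_eq_iff {g : G} :
    cosetShift H g (baseIndicator H) = baseIndicator H ↔ g ∈ H := by
  have h1 : cosetShift H 1 (baseIndicator H) = baseIndicator H := by simp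
  constructor
  · intro h
    by_contra hg
    have h2 := cosetShift_baseIndicator_apply_self (H := H) g
    rw [h, ← h1, cosetShift_baseIndicator_apply_of_ne] at h2
    · exact zero_ne_one h2
    · intro h3
      rw [QuotientGroup.eq] at h3
      apply hg
      simpa using h3
  · intro hg
    have hgg : ((g : G) : G ⧸ H) = ((1 : G) : G ⧸ H) := by
      rw [QuotientGroup.eq]
      simpa using hg
    ext x
    by_cases hx : x = ((1 : G) : G ⧸ H)
    · rw [hx, ← hgg, cosetShift_baseIndicator_apply_self, hgg, baseIndicator]
      simp
    · rw [cosetShift_baseIndicator_apply_of_ne (hgg ▸ hx), ← h1,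
        cosetShift_baseIndicator_apply_of_ne hx]

variable (H) in
/-- An affine action `Θ` of `G` on the integer-valued functions on `G ⧸ H` whose linear part is
translation and for which `H` fixes the origin. -/
structure IsCosetAffine (Θ : G →* Equiv.Perm (G ⧸ H → ℤ)) : Prop where
  sub : ∀ g f f', Θ g f - Θ g f' = cosetShift H g (f - f')
  fix : ∀ h ∈ H, Θ h 0 = 0

variable (Θ : G →* Equiv.Perm (G ⧸ H → ℤ))

/-- The vertices of the splitting tree of an affine action: the orbits of the origin and of the
indicator of the trivial coset. -/
def SplittingVertex : Type :=
  {f : G ⧸ H → ℤ // ∃ g, f = Θ g 0 ∨ f = Θ g (baseIndicator H)}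

/-- The vertex of the splitting tree that is the translate of the origin by `g`. -/
def SplittingVertex.left (g : G) : SplittingVertex Θ := ⟨Θ g 0, g, Or.inl rfl⟩

/-- The vertex of the splitting tree that is the translate of the base indicator by `g`. -/
noncomputable def SplittingVertex.right (g : G) : SplittingVertex Θ :=
  ⟨Θ g (baseIndicator H), g, Or.inr rfl⟩

theorem SplittingVertex.eq_left_or_right (w : SplittingVertex Θ) :
    ∃ g, w = left Θ g ∨ w = right Θ g := by
  obtain ⟨f, g, rfl | rfl⟩ := w
  exacts [⟨g, Or.inl rfl⟩, ⟨g, Or.inr rfl⟩]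

/-- The action of `G` on the splitting tree. -/
def splittingAction : G →* Equiv.Perm (SplittingVertex Θ) where
  toFun g := (Θ g).subtypePerm (p := fun f => ∃ g, f = Θ g 0 ∨ f = Θ g (baseIndicator H)) (by
    intro f
    constructor
    · rintro ⟨k, h | h⟩
      · exact ⟨g⁻¹ * k, Or.inl (by rw [map_mul, Equiv.Perm.mul_apply, ← h]; simp)⟩
      · exact ⟨g⁻¹ * k, Or.inr (by rw [map_mul, Equiv.Perm.mul_apply, ← h]; simp)⟩
    · rintro ⟨k, rfl | rfl⟩
      · exact ⟨g * k, Or.inl (by simp)⟩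
      · exact ⟨g * k, Or.inr (by simp)⟩)
  map_one' := Equiv.ext fun x => Subtype.ext (by simp [Equiv.Perm.subtypePerm_apply]; rfl)
  map_mul' a b := Equiv.ext fun x => Subtype.ext (by simp [Equiv.Perm.subtypePerm_apply]; rfl)

theorem splittingAction_val (g : G) (w : SplittingVertex Θ) :
    (splittingAction Θ g w).val = Θ g w.val := rfl

theorem splittingAction_left (g k : G) :
    splittingAction Θ g (.left Θ k) = .left Θ (g * k) :=
  Subtype.ext (by rw [splittingAction_val]; simp [SplittingVertex.left])

theorem splittingAction_right (g k : G) :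
    splittingAction Θ g (.right Θ k) = .right Θ (g * k) :=
  Subtype.ext (by rw [splittingAction_val]; simp [SplittingVertex.right])

variable {Θ}

theorem IsCosetAffine.right_sub_left (hΘ : IsCosetAffine H Θ) (g : G) :
    (SplittingVertex.right Θ g).val - (SplittingVertex.left Θ g).val =
      cosetShift H g (baseIndicator H) := by
  simp [SplittingVertex.left, SplittingVertex.right, hΘ.sub]

theorem IsCosetAffine.right_eq_add (hΘ : IsCosetAffine H Θ) (g : G) (x : G ⧸ H) :
    (SplittingVertex.right Θ g).val x =
      (SplittingVertex.left Θ g).val x + cosetShift H g (baseIndicator H) x := by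
  rw [← hΘ.right_sub_left]
  simp

theorem IsCosetAffine.right_ne_left (hΘ : IsCosetAffine H Θ) (g : G) :
    SplittingVertex.right Θ g ≠ SplittingVertex.left Θ g := by
  intro h
  have := hΘ.right_eq_add g g
  rw [h, cosetShift_baseIndicator_apply_self] at this
  omega

theorem IsCosetAffine.fix_baseIndicator (hΘ : IsCosetAffine H Θ) {h : G} (hh : h ∈ H) :
    Θ h (baseIndicator H) = baseIndicator H := by
  have := hΘ.sub h (baseIndicator H) 0
  rwa [hΘ.fix h hh, sub_zero, sub_zero, cosetShift_baseIndicator_eq_iff.2 hh] at this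

/-- The splitting tree of an affine action. -/
def splittingTree (hΘ : IsCosetAffine H Θ) : SimpleGraph (SplittingVertex Θ) where
  Adj w w' := ∃ g, (w = .left Θ g ∧ w' = .right Θ g) ∨ (w = .right Θ g ∧ w' = .left Θ g)
  symm := ⟨by
    rintro w w' ⟨g, h | h⟩
    exacts [⟨g, Or.inr h.symm⟩, ⟨g, Or.inl h.symm⟩]⟩
  loopless := ⟨by
    rintro w ⟨g, ⟨h1, h2⟩ | ⟨h1, h2⟩⟩
    · exact hΘ.right_ne_left g (h2.symm.trans h1)
    · exact hΘ.right_ne_left g (h1.symm.trans h2)⟩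

theorem splittingTree_adj (hΘ : IsCosetAffine H Θ) (g : G) :
    (splittingTree hΘ).Adj (.left Θ g) (.right Θ g) :=
  ⟨g, Or.inl ⟨rfl, rfl⟩⟩

theorem splittingTree_isAcyclic (hΘ : IsCosetAffine H Θ) : (splittingTree hΘ).IsAcyclic := by
  have key : ∀ g : G, ∃ c : SplittingVertex Θ → ℤ, c (.left Θ g) ≠ c (.right Θ g) ∧
      ∀ a b, (splittingTree hΘ).Adj a b → s(a, b) ≠ s(.left Θ g, .right Θ g) → c a = c b := by
    intro g
    refine ⟨fun w => w.val (g : G ⧸ H), ?_, ?_⟩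
    · have := hΘ.right_eq_add g g
      rw [cosetShift_baseIndicator_apply_self] at this
      simp only
      omega
    · have main : ∀ k : G, s(SplittingVertex.left Θ k, SplittingVertex.right Θ k) ≠
          s(.left Θ g, .right Θ g) →
          (SplittingVertex.left Θ k).val (g : G ⧸ H) =
            (SplittingVertex.right Θ k).val (g : G ⧸ H) := by
        intro k hk
        rw [hΘ.right_eq_add, cosetShift_baseIndicator_apply_of_ne, add_zero]
        intro hgk
        apply hk
        rw [QuotientGroup.eq] at hgk
        have hkg : k = g * (g⁻¹ * k) := by group
        have hl : SplittingVertex.left Θ k = SplittingVertex.left Θ g := by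
          apply Subtype.ext
          change Θ k 0 = Θ g 0
          rw [hkg, map_mul, Equiv.Perm.mul_apply, hΘ.fix _ hgk]
        have hr : SplittingVertex.right Θ k = SplittingVertex.right Θ g := by
          apply Subtype.ext
          change Θ k _ = Θ g _
          rw [hkg, map_mul, Equiv.Perm.mul_apply, hΘ.fix_baseIndicator hgk]
        rw [hl, hr]
      rintro a b ⟨k, ⟨rfl, rfl⟩ | ⟨rfl, rfl⟩⟩ hne
      · exact main k hne
      · exact (main k (by rwa [Sym2.eq_swap])).symm
  apply SimpleGraph.isAcyclic_of_separating
  rintro u v ⟨g, ⟨rfl, rfl⟩ | ⟨rfl, rfl⟩⟩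
  · exact key g
  · obtain ⟨c, hc, hc'⟩ := key g
    exact ⟨c, hc.symm, fun a b hab hne => hc' a b hab (by
      rwa [Sym2.eq_swap (a := SplittingVertex.left Θ g)])⟩

theorem splittingTree_connected (hΘ : IsCosetAffine H Θ) {S : Set G}
    (hS : Subgroup.closure S = ⊤)
    (hfix : ∀ s ∈ S, Θ s 0 = 0 ∨ Θ s (baseIndicator H) = baseIndicator H) :
    (splittingTree hΘ).Connected := by
  have hstep : ∀ k s, s ∈ S →
      (splittingTree hΘ).Reachable (.left Θ (k * s)) (.left Θ k) := by
    intro k s hs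
    rcases hfix s hs with h | h
    · have : SplittingVertex.left Θ (k * s) = SplittingVertex.left Θ k :=
        Subtype.ext (by simp [SplittingVertex.left, h])
      rw [this]
    · have : SplittingVertex.right Θ (k * s) = SplittingVertex.right Θ k :=
        Subtype.ext (by simp [SplittingVertex.right, h])
      exact (this ▸ (splittingTree_adj hΘ (k * s)).reachable).trans
        (splittingTree_adj hΘ k).reachable.symm
  have hleft : ∀ g : G, (splittingTree hΘ).Reachable (.left Θ g) (.left Θ 1) := by
    intro g
    have hg : g ∈ Subgroup.closure S := hS ▸ Subgroup.mem_top g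
    induction hg using Subgroup.closure_induction_right with
    | one => exact .rfl
    | mul_right k _ s hs ih => exact (hstep k s hs).trans ih
    | mul_inv_cancel k _ s hs ih =>
      have := hstep (k * s⁻¹) s hs
      rw [inv_mul_cancel_right] at this
      exact this.symm.trans ih
  have hall : ∀ w, (splittingTree hΘ).Reachable w (.left Θ 1) := by
    intro w
    obtain ⟨g, rfl | rfl⟩ := w.eq_left_or_right
    · exact hleft g
    · exact (splittingTree_adj hΘ g).reachable.symm.trans (hleft g)
  have : Nonempty (SplittingVertex Θ) := ⟨.left Θ 1⟩
  exact ⟨fun w w' => (hall w).trans (hall w').symm⟩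

theorem splittingAction_preservesAdj (hΘ : IsCosetAffine H Θ) :
    PreservesAdj (splittingTree hΘ) (splittingAction Θ) := by
  rintro g _ _ ⟨k, ⟨rfl, rfl⟩ | ⟨rfl, rfl⟩⟩
  · exact ⟨g * k, Or.inl ⟨splittingAction_left Θ g k, splittingAction_right Θ g k⟩⟩
  · exact ⟨g * k, Or.inr ⟨splittingAction_right Θ g k, splittingAction_left Θ g k⟩⟩

theorem splittingAction_noInversions (hΘ : IsCosetAffine H Θ) :
    NoInversions (splittingTree hΘ) (splittingAction Θ) := by
  have key : ∀ g k : G, splittingAction Θ g (.left Θ k) = .right Θ k →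
      splittingAction Θ g (.right Θ k) = .left Θ k → False := by
    intro g k h1 h2
    rw [splittingAction_left] at h1
    rw [splittingAction_right] at h2
    have h3 := hΘ.right_eq_add (g * k) (g * k : G)
    have h4 := hΘ.right_eq_add k (g * k : G)
    rw [h1, h2, h4, cosetShift_baseIndicator_apply_self] at h3
    by_cases h5 : ((g * k : G) : G ⧸ H) = (k : G ⧸ H)
    · rw [h5, cosetShift_baseIndicator_apply_self] at h3
      omega
    · rw [cosetShift_baseIndicator_apply_of_ne h5] at h3
      omega
  rintro g _ _ ⟨k, ⟨rfl, rfl⟩ | ⟨rfl, rfl⟩⟩ ⟨h1, h2⟩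
  · exact key g k h1 h2
  · exact key g k h2 h1

theorem splittingAction_abelianEdgeStabilizers (hΘ : IsCosetAffine H Θ)
    (hH : ∀ g ∈ H, ∀ h ∈ H, g * h = h * g) :
    AbelianEdgeStabilizers (splittingTree hΘ) (splittingAction Θ) := by
  have mem : ∀ g k : G, splittingAction Θ g (.left Θ k) = .left Θ k →
      splittingAction Θ g (.right Θ k) = .right Θ k → k⁻¹ * g * k ∈ H := by
    intro g k h1 h2
    have h3 := hΘ.right_sub_left (g * k)
    rw [← splittingAction_left, ← splittingAction_right, h1, h2, hΘ.right_sub_left] at h3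
    rw [← cosetShift_baseIndicator_eq_iff, mul_assoc, map_mul, Equiv.Perm.mul_apply, ← h3,
      ← Equiv.Perm.mul_apply, ← map_mul]
    simp
  have key : ∀ k g h : G, k⁻¹ * g * k ∈ H → k⁻¹ * h * k ∈ H → g * h = h * g := by
    intro k g h hg hh
    have := hH _ hg _ hh
    have h2 : k * (k⁻¹ * g * k * (k⁻¹ * h * k)) * k⁻¹ =
      k * (k⁻¹ * h * k * (k⁻¹ * g * k)) * k⁻¹ := by rw [this]
    simpa [mul_assoc] using h2
  rintro _ _ ⟨k, ⟨rfl, rfl⟩ | ⟨rfl, rfl⟩⟩ g h hg1 hg2 hh1 hh2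
  · exact key k g h (mem g k hg1 hg2) (mem h k hh1 hh2)
  · exact key k g h (mem g k hg2 hg1) (mem h k hh2 hh1)

theorem splittingAction_not_hasGlobalFixedVertex
    (h0 : ∃ g, Θ g 0 ≠ 0) (h1 : ∃ g, Θ g (baseIndicator H) ≠ baseIndicator H) :
    ¬ HasGlobalFixedVertex (splittingAction Θ) := by
  have key : ∀ (f : G ⧸ H → ℤ) (k : G), (∀ g, Θ g (Θ k f) = Θ k f) → ∀ g, Θ g f = f := by
    intro f k h g
    apply (Θ k).injective
    have := h (k * g * k⁻¹)
    rwa [← Equiv.Perm.mul_apply, ← map_mul, inv_mul_cancel_right, map_mul,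
      Equiv.Perm.mul_apply] at this
  rintro ⟨⟨_, k, rfl | rfl⟩, hw⟩
  · obtain ⟨g, hg⟩ := h0
    exact hg (key _ k (fun g => congrArg Subtype.val (hw g)) g)
  · obtain ⟨g, hg⟩ := h1
    exact hg (key _ k (fun g => congrArg Subtype.val (hw g)) g)

end CosetFunctions

/-- The right-angled Artin group of a graph with a separating clique splits over an abelian
subgroup. -/
theorem exists_action_of_separatingClique {V : Type} {Γ : SimpleGraph V} {K : Set V}
    (hK : SeparatingClique Γ K) :
    ∃ (W : Type) (T : SimpleGraph W) (φ : RAAG Γ →* Equiv.Perm W),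
        T.IsTree ∧ PreservesAdj T φ ∧ NoInversions T φ ∧
          AbelianEdgeStabilizers T φ ∧ ¬ HasGlobalFixedVertex φ := by
  classical
  obtain ⟨hclique, x, y, hxy⟩ := hK
  let H : Subgroup (RAAG Γ) := Subgroup.closure (RAAG.gen Γ '' K)
  let C : Set V := {v | ∃ h : v ∈ Kᶜ, (Γ.induce Kᶜ).Reachable x ⟨v, h⟩}
  have hCadj : ∀ u v, Γ.Adj u v → u ∈ C → v ∉ K → v ∈ C := by
    rintro u v huv ⟨hu, hr⟩ hv
    have hstep : (Γ.induce Kᶜ).Adj ⟨u, hu⟩ ⟨v, hv⟩ := huv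
    exact ⟨hv, hr.trans hstep.reachable⟩
  have hxC : x.val ∈ C := ⟨x.2, .rfl⟩
  have hyC : y.val ∉ C := fun ⟨_, h⟩ => hxy h
  have hCK : ∀ v ∈ C, v ∉ K := fun v hv => hv.1
  let τ : Equiv.Perm (RAAG Γ ⧸ H → ℤ) := Equiv.addRight (baseIndicator H)
  let S : V → Equiv.Perm (RAAG Γ ⧸ H → ℤ) := fun v => cosetShift H (RAAG.gen Γ v)
  have hS : ∀ u v, Γ.Adj u v → Commute (S u) (S v) := fun u v huv =>
    (RAAG.commute_gen huv).map (cosetShift H)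
  have hSK : ∀ v ∈ K, τ * S v * τ⁻¹ = S v := by
    intro v hv
    have hδ : S v (baseIndicator H) = baseIndicator H :=
      cosetShift_baseIndicator_eq_iff.2 (Subgroup.subset_closure ⟨v, hv, rfl⟩)
    rw [mul_inv_eq_iff_eq_mul]
    ext1 f
    change S v f + baseIndicator H = S v (f + baseIndicator H)
    conv_lhs => rw [← hδ]
    rfl
  let F : V → Equiv.Perm (RAAG Γ ⧸ H → ℤ) := fun v =>
    if v ∈ C then S v else τ * S v * τ⁻¹
  have hFC : ∀ v, v ∈ C ∨ v ∈ K → F v = S v := by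
    rintro v (hv | hv)
    · simp [F, hv]
    · simp only [F, hSK v hv, ite_self]
  have hFnC : ∀ v, v ∉ C → F v = τ * S v * τ⁻¹ := fun v hv => by simp [F, hv]
  have hF : ∀ u v, Γ.Adj u v → Commute (F u) (F v) := by
    intro u v huv
    by_cases h : u ∈ C ∨ v ∈ C
    · have huK : u ∈ C ∨ u ∈ K := by
        by_contra! hcon
        exact hcon.1 (hCadj v u huv.symm (h.resolve_left hcon.1) hcon.2)
      have hvK : v ∈ C ∨ v ∈ K := by
        by_contra! hcon
        exact hcon.1 (hCadj u v huv (h.resolve_right hcon.1) hcon.2)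
      rw [hFC u huK, hFC v hvK]
      exact hS u v huv
    · rw [not_or] at h
      rw [hFnC u h.1, hFnC v h.2]
      exact (hS u v huv).conj τ
  let Θ : RAAG Γ →* Equiv.Perm (RAAG Γ ⧸ H → ℤ) := RAAG.lift F hF
  have hΘgen : ∀ v, Θ (RAAG.gen Γ v) = F v := RAAG.lift_gen F hF
  have hsubgen : ∀ v f f', F v f - F v f' = S v (f - f') := by
    intro v f f'
    by_cases hv : v ∈ C
    · rw [hFC v (Or.inl hv)]
      rfl
    · rw [hFnC v hv]
      change (S v (f + - baseIndicator H) + baseIndicator H) -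
        (S v (f' + - baseIndicator H) + baseIndicator H) = _
      rw [add_sub_add_right_eq_sub]
      change S v ((f + - baseIndicator H) - (f' + - baseIndicator H)) = _
      rw [add_sub_add_right_eq_sub]
  have hsub : ∀ g f f', Θ g f - Θ g f' = cosetShift H g (f - f') := by
    intro g
    have hg : g ∈ Subgroup.closure (Set.range (RAAG.gen Γ)) :=
      RAAG.closure_range_gen Γ ▸ Subgroup.mem_top g
    induction hg using Subgroup.closure_induction with
    | mem g hg =>
      obtain ⟨v, rfl⟩ := hg
      rw [hΘgen]
      exact hsubgen v
    | one => simp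
    | mul a b _ _ iha ihb =>
      intro f f'
      simp only [map_mul, Equiv.Perm.mul_apply]
      rw [iha, ihb]
    | inv a _ iha =>
      intro f f'
      rw [map_inv, map_inv, Equiv.Perm.eq_inv_iff_eq, ← iha]
      simp
  have hfix : ∀ h ∈ H, Θ h 0 = 0 := by
    intro h hh
    have : H ≤ (MulAction.stabilizer (Equiv.Perm (RAAG Γ ⧸ H → ℤ))
        (0 : RAAG Γ ⧸ H → ℤ)).comap Θ := by
      rw [Subgroup.closure_le]
      rintro _ ⟨v, hv, rfl⟩
      change Θ (RAAG.gen Γ v) 0 = 0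
      rw [hΘgen, hFC v (Or.inr hv)]
      rfl
    exact this hh
  have hΘ : IsCosetAffine H Θ := ⟨hsub, hfix⟩
  refine ⟨SplittingVertex Θ, splittingTree hΘ, splittingAction Θ,
    ⟨splittingTree_connected hΘ (RAAG.closure_range_gen Γ) ?_, splittingTree_isAcyclic hΘ⟩,
    splittingAction_preservesAdj hΘ, splittingAction_noInversions hΘ,
    splittingAction_abelianEdgeStabilizers hΘ fun g hg h hh =>
      RAAG.commute_of_mem_closure Γ hclique hg hh,
    splittingAction_not_hasGlobalFixedVertex ⟨RAAG.gen Γ y, ?_⟩ ⟨RAAG.gen Γ x, ?_⟩⟩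
  · rintro _ ⟨v, rfl⟩
    rw [hΘgen]
    by_cases hv : v ∈ C
    · left
      rw [hFC v (Or.inl hv)]
      rfl
    · right
      rw [hFnC v hv]
      change S v (baseIndicator H + - baseIndicator H) + baseIndicator H = _
      rw [add_neg_cancel]
      change (0 : RAAG Γ ⧸ H → ℤ) + _ = _
      rw [zero_add]
  · rw [hΘgen, hFnC _ hyC]
    intro h
    apply RAAG.gen_notMem_closure Γ y.2
    change _ ∈ H
    change S y (0 - baseIndicator H) + baseIndicator H = 0 at h
    rw [← cosetShift_baseIndicator_eq_iff]
    have h2 : S y (0 - baseIndicator H) = 0 - S y (baseIndicator H) := rfl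
    rw [h2, zero_sub, neg_add_eq_zero] at h
    exact h
  · rw [hΘgen, hFC _ (Or.inl hxC)]
    intro h
    exact RAAG.gen_notMem_closure Γ x.2 (cosetShift_baseIndicator_eq_iff.1 h)

/-- The graph on the integers in which consecutive integers are adjacent. -/
def integerLine : SimpleGraph ℤ where
  Adj i j := j = i + 1 ∨ i = j + 1
  symm := ⟨fun _ _ h => h.symm⟩
  loopless := ⟨fun _ h => by omega⟩

theorem integerLine_isTree : integerLine.IsTree := by
  refine ⟨⟨fun i j => ?_⟩, ?_⟩
  · have key : ∀ (n : ℕ) (i : ℤ), integerLine.Reachable i (i + n) := by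
      intro n
      induction n with
      | zero => simp
      | succ n ih =>
        intro i
        have hadj : integerLine.Adj (i + n) (i + (n + 1 : ℕ)) := Or.inl (by push_cast; ring)
        exact (ih i).trans hadj.reachable
    rcases le_total i j with h | h
    · have := key (j - i).toNat i
      rwa [show i + ((j - i).toNat : ℤ) = j by omega] at this
    · have := key (i - j).toNat j
      rw [show j + ((i - j).toNat : ℤ) = i by omega] at this
      exact this.symm
  · apply SimpleGraph.isAcyclic_of_separating
    intro u v huv
    refine ⟨fun w => if w ≤ min u v then 0 else 1, ?_, ?_⟩
    · rcases huv with rfl | rfl <;> simp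
    · intro a b hab hne
      have hne' : ¬ ((a = u ∧ b = v) ∨ (a = v ∧ b = u)) := by
        rintro (⟨rfl, rfl⟩ | ⟨rfl, rfl⟩)
        exacts [hne rfl, hne Sym2.eq_swap]
      change b = a + 1 ∨ a = b + 1 at hab
      change v = u + 1 ∨ u = v + 1 at huv
      have : a ≤ min u v ↔ b ≤ min u v := by omega
      simp [this]

/-- The right-angled Artin group of a nonempty complete graph splits over an abelian subgroup. -/
theorem exists_action_of_complete {V : Type} [Nonempty V] {Γ : SimpleGraph V}
    (h : ∀ u v : V, u ≠ v → Γ.Adj u v) :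
    ∃ (W : Type) (T : SimpleGraph W) (φ : RAAG Γ →* Equiv.Perm W),
        T.IsTree ∧ PreservesAdj T φ ∧ NoInversions T φ ∧
          AbelianEdgeStabilizers T φ ∧ ¬ HasGlobalFixedVertex φ := by
  let ψ : RAAG Γ →* Multiplicative ℤ :=
    RAAG.lift (fun _ => Multiplicative.ofAdd 1) fun _ _ _ => Commute.all _ _
  let φ : RAAG Γ →* Equiv.Perm ℤ := (MulAction.toPermHom (Multiplicative ℤ) ℤ).comp ψ
  have hφ : ∀ g i, φ g i = (ψ g).toAdd + i := fun _ _ => rfl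
  refine ⟨ℤ, integerLine, φ, integerLine_isTree, ?_, ?_, ?_, ?_⟩
  · intro g u v huv
    change v = u + 1 ∨ u = v + 1 at huv
    change _ = _ + 1 ∨ _ = _ + 1
    rw [hφ, hφ]
    omega
  · intro g u v huv
    change v = u + 1 ∨ u = v + 1 at huv
    rw [hφ, hφ]
    omega
  · intro _ _ _ g k _ _ _ _
    have hmem : ∀ g : RAAG Γ, g ∈ Subgroup.closure (RAAG.gen Γ '' Set.univ) := fun g => by
      rw [Set.image_univ, RAAG.closure_range_gen]
      exact Subgroup.mem_top g
    exact RAAG.commute_of_mem_closure Γ (fun u _ v _ => h u v) (hmem g) (hmem k)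
  · rintro ⟨w, hw⟩
    obtain ⟨v⟩ := ‹Nonempty V›
    have := hw (RAAG.gen Γ v)
    simp [hφ, ψ] at this

namespace SimpleGraph

variable {W : Type*} {T : SimpleGraph W}

theorem Connected.exists_adj_dist_eq_add_one (hT : T.Connected) {x p : W} (h : x ≠ p) :
    ∃ y, T.Adj x y ∧ T.dist x p = T.dist y p + 1 := by
  obtain ⟨w, hw⟩ := hT.exists_walk_length_eq_dist x p
  cases w with
  | nil => exact absurd rfl h
  | @cons _ y _ hadj q =>
    refine ⟨y, hadj, ?_⟩
    have h1 := T.dist_le q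
    have h2 := hT.dist_triangle (u := x) (v := y) (w := p)
    rw [dist_eq_one_iff_adj.2 hadj] at h2
    rw [Walk.length_cons] at hw
    omega

theorem IsTree.eq_of_adj_of_dist_eq_add_one (hT : T.IsTree) {x p a b : W} (ha : T.Adj x a)
    (hb : T.Adj x b) (hap : T.dist x p = T.dist a p + 1) (hbp : T.dist x p = T.dist b p + 1) :
    a = b := by
  obtain ⟨q, hq⟩ := hT.connected.exists_walk_length_eq_dist a p
  obtain ⟨r, hr⟩ := hT.connected.exists_walk_length_eq_dist b p
  have h1 : (Walk.cons ha q).IsPath :=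
    Walk.isPath_of_length_eq_dist _ (by rw [Walk.length_cons, hq, hap])
  have h2 : (Walk.cons hb r).IsPath :=
    Walk.isPath_of_length_eq_dist _ (by rw [Walk.length_cons, hr, hbp])
  have := (hT.existsUnique_path x p).unique h1 h2
  simpa using congrArg Walk.snd this

/-- In a tree, if the first edge of the path from `x` to `z` does not lead towards `y`, then `x`
lies between `y` and `z`. -/
theorem IsTree.dist_eq_add (hT : T.IsTree) {x y z a : W} (ha : T.Adj x a)
    (haz : T.dist x z = T.dist a z + 1) (hay : T.dist x y ≠ T.dist a y + 1) :
    T.dist y z = T.dist y x + T.dist x z := by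
  induction hn : T.dist x z generalizing x a with
  | zero => omega
  | succ n ih =>
    have hax : T.dist a y = T.dist x y + 1 := by
      have := hT.dist_eq_dist_add_one_of_adj y ha
      simp only [T.dist_comm (u := y)] at this
      omega
    rw [T.dist_comm (u := y) (v := x)]
    by_cases haz' : a = z
    · subst haz'
      rw [dist_self] at haz
      rw [T.dist_comm (u := y)]
      omega
    · obtain ⟨b, hab, hbz⟩ := hT.connected.exists_adj_dist_eq_add_one haz'
      have := ih hab hbz (fun hby => by
        have := hT.eq_of_adj_of_dist_eq_add_one hab ha.symm hby hax
        subst this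
        omega) (by omega)
      rw [this, T.dist_comm (u := y)]
      omega

/-- The four-point condition for the distance of a tree. -/
theorem IsTree.dist_add_dist_le (hT : T.IsTree) (x y z w : W) :
    T.dist x y + T.dist z w ≤ max (T.dist x z + T.dist y w) (T.dist x w + T.dist y z) := by
  induction hn : T.dist x y generalizing x with
  | zero =>
    rw [hT.connected.dist_eq_zero_iff] at hn
    subst hn
    have := hT.connected.dist_triangle (u := z) (v := x) (w := w)
    rw [T.dist_comm (u := z) (v := x)] at this
    omega
  | succ n ih =>
    have hxy : x ≠ y := by
      rintro rfl
      simp at hn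
    obtain ⟨a, ha, hay⟩ := hT.connected.exists_adj_dist_eq_add_one hxy
    have hzw := hT.connected.dist_triangle (u := z) (v := x) (w := w)
    rw [T.dist_comm (u := z) (v := x)] at hzw
    by_cases haz : T.dist x z = T.dist a z + 1
    · by_cases haw : T.dist x w = T.dist a w + 1
      · have := ih a (by omega)
        omega
      · have := hT.dist_eq_add ha hay haw
        rw [T.dist_comm (u := w) (v := y), T.dist_comm (u := w) (v := x)] at this
        omega
    · have := hT.dist_eq_add ha hay haz
      rw [T.dist_comm (u := z) (v := y), T.dist_comm (u := z) (v := x)] at this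
      omega

/-- In a tree, two points at the same distances from the endpoints of a geodesic on which they
lie are equal. -/
theorem IsTree.eq_of_dist_eq (hT : T.IsTree) {p q x y : W}
    (hx : T.dist p x + T.dist x q = T.dist p q) (hp : T.dist p x = T.dist p y)
    (hq : T.dist x q = T.dist y q) : x = y := by
  rw [← hT.connected.dist_eq_zero_iff]
  have := hT.dist_add_dist_le x y p q
  rw [T.dist_comm (u := x) (v := p), T.dist_comm (u := y) (v := p)] at this
  omega

end SimpleGraph

section TreeAction

variable {G W : Type} [Group G] {T : SimpleGraph W} {φ : G →* Equiv.Perm W}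

theorem PreservesAdj.dist_map (hφ : PreservesAdj T φ) (hT : T.IsTree) (g : G) (u v : W) :
    T.dist (φ g u) (φ g v) = T.dist u v := by
  have key : ∀ (g : G) (u v : W), T.dist (φ g u) (φ g v) ≤ T.dist u v := by
    intro g u v
    obtain ⟨p, hp⟩ := hT.connected.exists_walk_length_eq_dist u v
    let f : T →g T := ⟨φ g, hφ g _ _⟩
    rw [← hp, ← p.length_map f]
    exact T.dist_le (p.map f)
  refine le_antisymm (key g u v) ?_
  simpa using key g⁻¹ (φ g u) (φ g v)

theorem PreservesAdj.fix_of_between (hφ : PreservesAdj T φ) (hT : T.IsTree) {g : G} {p q x : W}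
    (hp : φ g p = p) (hq : φ g q = q) (hx : T.dist p x + T.dist x q = T.dist p q) :
    φ g x = x := by
  refine (hT.eq_of_dist_eq hx ?_ ?_).symm
  · conv_rhs => rw [← hp, hφ.dist_map hT]
  · conv_rhs => rw [← hq, hφ.dist_map hT]

theorem apply_comm_of_commute (φ : G →* Equiv.Perm W) {g h : G} (hgh : Commute g h) (x : W) :
    φ g (φ h x) = φ h (φ g x) := by
  rw [← Equiv.Perm.mul_apply, ← map_mul, hgh.eq, map_mul, Equiv.Perm.mul_apply]

theorem Elliptic.exists_common_fixed (hφ : PreservesAdj T φ) (hT : T.IsTree) {u v : G}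
    (huv : Commute u v) (hu : Elliptic φ u) (hv : Elliptic φ v) :
    ∃ w, φ u w = w ∧ φ v w = w := by
  let S := {r : W × W // φ u r.1 = r.1 ∧ φ v r.2 = r.2}
  obtain ⟨q₀, hq₀⟩ := hu
  obtain ⟨p₀, hp₀⟩ := hv
  have : Nonempty S := ⟨⟨(q₀, p₀), hq₀, hp₀⟩⟩
  let f : S → ℕ := fun r => T.dist r.1.1 r.1.2
  obtain ⟨⟨⟨q, p⟩, hq, hp⟩, hmin⟩ : ∃ r : S, ∀ s : S, f r ≤ f s :=
    ⟨Function.argmin f, fun s => Function.argmin_le f s⟩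
  simp only at hq hp
  have hq1 : φ u (φ v q) = φ v q := by rw [apply_comm_of_commute φ huv, hq]
  have hdist : T.dist (φ v q) p = T.dist q p := by
    conv_lhs => rw [← hp, hφ.dist_map hT]
  by_cases hqp : q = p
  · exact ⟨q, hq, hqp ▸ hp⟩
  obtain ⟨a, ha, hap⟩ := hT.connected.exists_adj_dist_eq_add_one hqp
  by_cases hav : T.dist q (φ v q) = T.dist a (φ v q) + 1
  · have hafix : φ u a = a := by
      apply hφ.fix_of_between hT hq hq1
      rw [SimpleGraph.dist_eq_one_iff_adj.2 ha]
      omega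
    have h1 : T.dist q p ≤ T.dist a p := hmin ⟨(a, p), hafix, hp⟩
    omega
  · have h1 := hT.dist_eq_add ha hap hav
    exact ⟨q, hq, hT.connected.dist_eq_zero_iff.1 (by omega)⟩

/-- A vertex minimally displaced by a non-elliptic element lies on a geodesic line along which the
element translates. -/
theorem dist_pow_of_minimal (hT : T.IsTree) (hφ : PreservesAdj T φ) (hinv : NoInversions T φ)
    {g : G} {x : W} (hx : φ g x ≠ x) (hmin : ∀ y, T.dist x (φ g x) ≤ T.dist y (φ g y)) (n : ℕ) :
    T.dist x (φ (g ^ n) x) = n * T.dist x (φ g x) := by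
  obtain ⟨y, hxy, hy⟩ := hT.connected.exists_adj_dist_eq_add_one hx.symm
  have hback : T.dist (φ g x) x ≠ T.dist (φ g y) x + 1 := by
    intro h
    rw [T.dist_comm (u := φ g x), T.dist_comm (u := φ g y)] at h
    have h1 : T.dist x y = 1 := SimpleGraph.dist_eq_one_iff_adj.2 hxy
    have h2 : T.dist (φ g x) (φ g y) = 1 := by rw [hφ.dist_map hT, h1]
    by_cases hl : T.dist x (φ g x) = 1
    · have h3 : y = φ g x := hT.connected.dist_eq_zero_iff.1 (by omega)
      have h4 : x = φ g y := hT.connected.dist_eq_zero_iff.1 (by omega)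
      exact hinv g x y hxy ⟨h3.symm, h4.symm⟩
    · have h3 := hT.dist_add_dist_le x (φ g x) y (φ g y)
      rw [T.dist_comm (u := φ g x) (v := y)] at h3
      have h4 := hmin y
      omega
  have hpow : ∀ (n : ℕ) (w : W), φ (g ^ (n + 1)) w = φ g (φ (g ^ n) w) := fun n w => by
    rw [pow_succ', map_mul, Equiv.Perm.mul_apply]
  have key : ∀ n : ℕ, T.dist x (φ (g ^ (n + 1)) x) = (n + 1) * T.dist x (φ g x) ∧
      T.dist x (φ (g ^ (n + 1)) x) = T.dist y (φ (g ^ (n + 1)) x) + 1 := by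
    intro n
    induction n with
    | zero => simpa using hy
    | succ n ih =>
      obtain ⟨ih1, ih2⟩ := ih
      have h1 := hT.dist_eq_add (x := φ g x) (y := x) (z := φ (g ^ (n + 1 + 1)) x) (hφ g _ _ hxy)
        (by rw [hpow, hφ.dist_map hT, hφ.dist_map hT, ih2]) hback
      have h2 : T.dist (φ g x) (φ (g ^ (n + 1 + 1)) x) = (n + 1) * T.dist x (φ g x) := by
        rw [hpow, hφ.dist_map hT, ih1]
      have h3 := hT.connected.dist_triangle (u := y) (v := φ g x) (w := φ (g ^ (n + 1 + 1)) x)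
      have h4 := hT.connected.dist_triangle (u := x) (v := y) (w := φ (g ^ (n + 1 + 1)) x)
      rw [SimpleGraph.dist_eq_one_iff_adj.2 hxy] at h4
      have h5 : (n + 1 + 1) * T.dist x (φ g x) =
        (n + 1) * T.dist x (φ g x) + T.dist x (φ g x) := by ring
      omega
  cases n with
  | zero => simp
  | succ n => exact (key n).1

/-- The commutator of two elements centralizing a non-elliptic element fixes every vertex that is
minimally displaced. -/
theorem apply_mul_comm_of_minimal (hT : T.IsTree) (hφ : PreservesAdj T φ)
    (hinv : NoInversions T φ) {g a b : G} (ha : Commute a g) (hb : Commute b g) {x : W}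
    (hx : φ g x ≠ x) (hmin : ∀ y, T.dist x (φ g x) ≤ T.dist y (φ g y)) :
    φ (a * b) x = φ (b * a) x := by
  set l := T.dist x (φ g x) with hl
  have hlpos : 0 < l := hT.connected.pos_dist_of_ne hx.symm
  -- translates of `x` by the centralizer of `g`
  have htrans : ∀ c : G, Commute c g → ∀ n : ℕ,
      T.dist (φ c x) (φ (g ^ n) (φ c x)) = n * l := by
    intro c hc n
    rw [apply_comm_of_commute φ (hc.pow_right n).symm, hφ.dist_map hT,
      dist_pow_of_minimal hT hφ hinv hx hmin]
  -- a far away base point on the line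
  let M := T.dist x (φ a x) + T.dist x (φ b x) + T.dist x (φ (a * b) x) +
    T.dist x (φ (b * a) x) + T.dist x (φ a⁻¹ x) + T.dist x (φ b⁻¹ x)
  obtain ⟨N, hN⟩ : ∃ N : ℕ, 4 * M < N := ⟨4 * M + 1, by omega⟩
  have hNl : N ≤ N * l := Nat.le_mul_of_pos_right N hlpos
  let p := φ (g ^ N)⁻¹ x
  let q := φ (g ^ N) x
  have hp : ∀ y, T.dist p y = T.dist x (φ (g ^ N) y) := by
    intro y
    rw [← hφ.dist_map hT (g ^ N)]
    simp [p]
  have hxx : T.dist x (φ (g ^ N) x) = N * l := dist_pow_of_minimal hT hφ hinv hx hmin N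
  have hpq : T.dist p q = 2 * (N * l) := by
    rw [hp, ← Equiv.Perm.mul_apply, ← map_mul, ← pow_add,
      dist_pow_of_minimal hT hφ hinv hx hmin]
    ring
  have hbetween : ∀ c : G, Commute c g → T.dist x (φ c x) ≤ M →
      T.dist p (φ c x) + T.dist (φ c x) q = T.dist p q := by
    intro c hc hM
    rw [hpq, hp]
    have h1 := hT.dist_add_dist_le x q (φ c x) (φ (g ^ N) (φ c x))
    have h2 := hT.dist_add_dist_le x (φ (g ^ N) (φ c x)) (φ c x) q
    have h3 : T.dist q (φ (g ^ N) (φ c x)) = T.dist x (φ c x) := hφ.dist_map hT _ _ _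
    have h4 := htrans c hc N
    have h5 : T.dist (φ (g ^ N) (φ c x)) (φ c x) = N * l := by rw [T.dist_comm, h4]
    rw [T.dist_comm (u := φ (g ^ N) (φ c x)) (v := q)] at h2
    rw [T.dist_comm (u := q) (v := φ c x)] at h1
    change T.dist x q = _ at hxx
    omega
  have hlower : ∀ y, N * l ≤ T.dist p y + T.dist x y := by
    intro y
    have h1 := hT.connected.dist_triangle (u := p) (v := y) (w := x)
    rw [hp x, hxx, T.dist_comm (u := y)] at h1
    exact h1
  have hshift : ∀ c : G, Commute c g → T.dist x (φ c⁻¹ x) ≤ M → ∀ y, T.dist x y ≤ M →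
      T.dist x (φ c x) ≤ M → T.dist x (φ c y) ≤ M →
      T.dist p (φ c y) + T.dist p x = T.dist p (φ c x) + T.dist p y := by
    intro c hc hcx y hy hcx' hcy
    have hpc : ∀ z, T.dist (φ c⁻¹ p) z = T.dist p (φ c z) := by
      intro z
      rw [← hφ.dist_map hT c]
      simp
    have hpp : T.dist (φ c⁻¹ p) p = T.dist x (φ c⁻¹ x) := by
      have : φ c⁻¹ p = φ (g ^ N)⁻¹ (φ c⁻¹ x) :=
        apply_comm_of_commute φ ((hc.pow_right N).inv_inv) x
      rw [this, hφ.dist_map hT, T.dist_comm]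
    have h1 := hT.dist_add_dist_le (φ c⁻¹ p) y p x
    have h2 := hT.dist_add_dist_le (φ c⁻¹ p) x p y
    rw [hpp] at h1 h2
    rw [hpc, hpc] at h1 h2
    rw [T.dist_comm (u := y) (v := p), T.dist_comm (u := y) (v := x)] at h1
    rw [T.dist_comm (u := x) (v := p)] at h2
    have h3 := hlower y
    have h4 := hlower x
    have h5 := hlower (φ c x)
    have h6 := hlower (φ c y)
    rw [T.dist_self] at h4
    omega
  have hab : φ (a * b) x = φ a (φ b x) := by rw [map_mul, Equiv.Perm.mul_apply]
  have hba : φ (b * a) x = φ b (φ a x) := by rw [map_mul, Equiv.Perm.mul_apply]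
  have h1 := hshift a ha (by omega) (φ b x) (by omega) (by omega) (by rw [← hab]; omega)
  have h2 := hshift b hb (by omega) (φ a x) (by omega) (by omega) (by rw [← hba]; omega)
  have h3 := hbetween (a * b) (ha.mul_left hb) (by omega)
  have h4 := hbetween (b * a) (hb.mul_left ha) (by omega)
  rw [← hab] at h1
  rw [← hba] at h2
  exact hT.eq_of_dist_eq h3 (by omega) (by omega)

/-- In an action with abelian edge stabilizers, commutators of elements centralizing a non-elliptic
element commute with each other. -/
theorem commute_commutators_of_not_elliptic (hT : T.IsTree) (hφ : PreservesAdj T φ)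
    (hinv : NoInversions T φ) (hab : AbelianEdgeStabilizers T φ) {g a b c d : G}
    (hg : ¬ Elliptic φ g) (ha : Commute a g) (hb : Commute b g) (hc : Commute c g)
    (hd : Commute d g) :
    Commute ((b * a)⁻¹ * (a * b)) ((d * c)⁻¹ * (c * d)) := by
  have := hT.connected.nonempty
  let f : W → ℕ := fun x => T.dist x (φ g x)
  obtain ⟨x, hmin⟩ : ∃ x, ∀ y, f x ≤ f y :=
    ⟨Function.argmin f, fun s => Function.argmin_le f s⟩
  have hne : ∀ y, φ g y ≠ y := fun y hy => hg ⟨y, hy⟩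
  obtain ⟨y, hxy, hy⟩ := hT.connected.exists_adj_dist_eq_add_one (hne x).symm
  have hyx : f y ≤ f x := by
    have h1 := hT.connected.dist_triangle (u := y) (v := φ g x) (w := φ g y)
    rw [hφ.dist_map hT, SimpleGraph.dist_eq_one_iff_adj.2 hxy] at h1
    simp only [f]
    omega
  have hfix : ∀ z, f z ≤ f x → ∀ a b : G, Commute a g → Commute b g →
      φ ((b * a)⁻¹ * (a * b)) z = z := by
    intro z hz a b ha hb
    rw [map_mul, Equiv.Perm.mul_apply, map_inv, Equiv.Perm.inv_eq_iff_eq]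
    exact apply_mul_comm_of_minimal hT hφ hinv ha hb (hne z) fun w => hz.trans (hmin w)
  exact hab x y hxy _ _ (hfix x le_rfl a b ha hb) (hfix y hyx a b ha hb)
    (hfix x le_rfl c d hc hd) (hfix y hyx c d hc hd)

end TreeAction

/-- Two distinct non-adjacent generators of a right-angled Artin group can be sent to any two
elements of any group. -/
theorem RAAG.exists_hom_of_not_adj {V : Type} {Γ : SimpleGraph V} {a b : V} (hne : a ≠ b)
    (hab : ¬ Γ.Adj a b) {P : Type*} [Group P] (x y : P) :
    ∃ ψ : RAAG Γ →* P, ψ (RAAG.gen Γ a) = x ∧ ψ (RAAG.gen Γ b) = y := by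
  classical
  refine ⟨RAAG.lift (fun v => if v = a then x else if v = b then y else 1) ?_, ?_, ?_⟩
  · intro u v huv
    have : u ≠ v := huv.ne
    have : ¬ Γ.Adj b a := fun h => hab h.symm
    split_ifs <;> first | exact Commute.one_left _ | exact Commute.one_right _ | simp_all
  · simp
  · simp [hne.symm]

theorem RAAG.not_commute_gen {V : Type} {Γ : SimpleGraph V} {a b : V} (hne : a ≠ b)
    (hab : ¬ Γ.Adj a b) : ¬ Commute (RAAG.gen Γ a) (RAAG.gen Γ b) := by
  intro h
  obtain ⟨ψ, ha, hb⟩ := RAAG.exists_hom_of_not_adj hne hab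
    (Equiv.swap 0 1 : Equiv.Perm (Fin 3)) (Equiv.swap 1 2)
  have := h.map ψ
  rw [ha, hb] at this
  revert this
  unfold Commute SemiconjBy
  decide

theorem RAAG.not_commute_commutators {V : Type} {Γ : SimpleGraph V} {a b : V} (hne : a ≠ b)
    (hab : ¬ Γ.Adj a b) :
    ¬ Commute ((RAAG.gen Γ b * RAAG.gen Γ a)⁻¹ * (RAAG.gen Γ a * RAAG.gen Γ b))
      ((RAAG.gen Γ b * RAAG.gen Γ a ^ 2)⁻¹ * (RAAG.gen Γ a ^ 2 * RAAG.gen Γ b)) := by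
  intro h
  obtain ⟨ψ, ha, hb⟩ := RAAG.exists_hom_of_not_adj hne hab
    (finRotate 4) (Equiv.swap 0 1)
  have := h.map ψ
  simp only [map_mul, map_inv, map_pow, ha, hb] at this
  revert this
  unfold Commute SemiconjBy
  decide

section Forward

variable {V : Type} {Γ : SimpleGraph V} {W : Type} {T : SimpleGraph W}
  {φ : RAAG Γ →* Equiv.Perm W}

theorem RAAG.elliptic_gen (hT : T.IsTree) (hφ : PreservesAdj T φ) (hinv : NoInversions T φ)
    (hab : AbelianEdgeStabilizers T φ) (hcomplete : ¬ ∀ u v : V, u ≠ v → Γ.Adj u v)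
    (hsep : ¬ ∃ K : Set V, SeparatingClique Γ K) (v : V) : Elliptic φ (RAAG.gen Γ v) := by
  by_contra hv
  have hclique : Γ.IsClique (Γ.neighborSet v) := by
    intro a ha b hb hne
    by_contra hadj
    have hav : Commute (RAAG.gen Γ a) (RAAG.gen Γ v) := (RAAG.commute_gen ha).symm
    have hbv : Commute (RAAG.gen Γ b) (RAAG.gen Γ v) := (RAAG.commute_gen hb).symm
    exact RAAG.not_commute_commutators hne hadj
      (commute_commutators_of_not_elliptic hT hφ hinv hab hv hav hbv (hav.pow_left 2) hbv)
  by_cases hw : ∃ w, w ≠ v ∧ ¬ Γ.Adj v w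
  · obtain ⟨w, hwv, hadj⟩ := hw
    refine hsep ⟨Γ.neighborSet v, hclique, ⟨v, Γ.irrefl⟩, ⟨w, hadj⟩, ?_⟩
    rintro ⟨p⟩
    cases p with
    | nil => exact hwv rfl
    | @cons _ u _ h _ => exact u.2 h
  · push Not at hw
    refine hcomplete fun a b hne => ?_
    by_cases ha : a = v
    · subst ha
      exact hw b hne.symm
    · by_cases hb : b = v
      · subst hb
        exact (hw a hne).symm
      · exact hclique (hw a ha) (hw b hb) hne

/-- In the absence of separating cliques, if one generator moves the initial vertex of an edge and
fixes a vertex beyond that edge, then all the generators that do not fix the edge have their fixed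
vertices beyond it. -/
theorem RAAG.fixed_beyond_edge (hT : T.IsTree) (hφ : PreservesAdj T φ)
    (hab : AbelianEdgeStabilizers T φ) (hsep : ¬ ∃ K : Set V, SeparatingClique Γ K)
    (hell : ∀ v, Elliptic φ (RAAG.gen Γ v)) {p q f₀ : W} (hpq : T.Adj p q) {v₀ : V}
    (hv₀ : φ (RAAG.gen Γ v₀) p ≠ p) (hf₀ : φ (RAAG.gen Γ v₀) f₀ = f₀)
    (hd₀ : T.dist p f₀ = T.dist q f₀ + 1) {v : V}
    (hv : ¬ (φ (RAAG.gen Γ v) p = p ∧ φ (RAAG.gen Γ v) q = q)) {f : W}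
    (hf : φ (RAAG.gen Γ v) f = f) : T.dist p f = T.dist q f + 1 := by
  let K : Set V := {v | φ (RAAG.gen Γ v) p = p ∧ φ (RAAG.gen Γ v) q = q}
  have hK : Γ.IsClique K := by
    intro a ha b hb hne
    by_contra hadj
    exact RAAG.not_commute_gen hne hadj (hab p q hpq _ _ ha.1 ha.2 hb.1 hb.2)
  have hreach : ∀ x y : ↥Kᶜ, (Γ.induce Kᶜ).Reachable x y := by
    by_contra! h
    exact hsep ⟨K, hK, h⟩
  have hside : ∀ u ∈ Kᶜ, ∀ f f', φ (RAAG.gen Γ u) f = f → φ (RAAG.gen Γ u) f' = f' →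
      T.dist p f = T.dist q f + 1 → T.dist p f' = T.dist q f' + 1 := by
    intro u hu f f' hf hf' hd
    by_contra hd'
    have h1 := hT.dist_eq_add hpq hd hd'
    have h2 := hT.dist_eq_dist_add_one_of_adj f' hpq
    have h3 := T.dist_comm (u := f') (v := p)
    have h4 := T.dist_comm (u := f') (v := q)
    exact hu ⟨hφ.fix_of_between hT hf' hf h1.symm,
      hφ.fix_of_between hT hf' hf (by omega)⟩
  have hwalk : ∀ {x y : ↥Kᶜ}, (Γ.induce Kᶜ).Walk x y →
      (∀ f, φ (RAAG.gen Γ x) f = f → T.dist p f = T.dist q f + 1) →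
      ∀ f, φ (RAAG.gen Γ y) f = f → T.dist p f = T.dist q f + 1 := by
    intro x y w
    induction w with
    | nil => exact id
    | @cons x z _ hadj _ ih =>
      intro hx
      apply ih
      intro f hf
      have hxz : Γ.Adj x z := hadj
      obtain ⟨f', hf'x, hf'z⟩ := Elliptic.exists_common_fixed hφ hT (RAAG.commute_gen hxz)
        (hell x) (hell z)
      exact hside z z.2 f' f hf'z hf (hx f' hf'x)
  have hv₀K : v₀ ∈ Kᶜ := fun h => hv₀ h.1
  obtain ⟨w⟩ := hreach ⟨v₀, hv₀K⟩ ⟨v, hv⟩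
  exact hwalk w (fun f hf => hside v₀ hv₀K f₀ f hf₀ hf hd₀) f hf

theorem RAAG.hasGlobalFixedVertex [Finite V] (hT : T.IsTree) (hφ : PreservesAdj T φ)
    (hinv : NoInversions T φ) (hab : AbelianEdgeStabilizers T φ)
    (hcomplete : ¬ ∀ u v : V, u ≠ v → Γ.Adj u v)
    (hsep : ¬ ∃ K : Set V, SeparatingClique Γ K) : HasGlobalFixedVertex φ := by
  have := Fintype.ofFinite V
  have hell := RAAG.elliptic_gen hT hφ hinv hab hcomplete hsep
  have : ∀ v, Nonempty {f // φ (RAAG.gen Γ v) f = f} := fun v => nonempty_subtype.2 (hell v)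
  let D : V → W → ℕ := fun v p => ⨅ f : {f // φ (RAAG.gen Γ v) f = f}, T.dist p f
  have hD : ∀ v p, ∃ f, φ (RAAG.gen Γ v) f = f ∧ T.dist p f = D v p := by
    intro v p
    obtain ⟨f, hf⟩ := ciInf_mem fun f : {f // φ (RAAG.gen Γ v) f = f} => T.dist p f
    exact ⟨f, f.2, hf⟩
  have hDle : ∀ v p f, φ (RAAG.gen Γ v) f = f → D v p ≤ T.dist p f := fun v p f hf =>
    ciInf_le' (fun f : {f // φ (RAAG.gen Γ v) f = f} => T.dist p f) ⟨f, hf⟩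
  have := hT.connected.nonempty
  let S : W → ℕ := fun p => ∑ v, D v p
  obtain ⟨p, hmin⟩ : ∃ p, ∀ q, S p ≤ S q :=
    ⟨Function.argmin S, fun s => Function.argmin_le S s⟩
  have hgen : ∀ v, φ (RAAG.gen Γ v) p = p := by
    by_contra! h
    obtain ⟨v₀, hv₀⟩ := h
    obtain ⟨f₀, hf₀, hfd⟩ := hD v₀ p
    have hne : p ≠ f₀ := fun h => hv₀ (h ▸ hf₀)
    obtain ⟨q, hpq, hd₀⟩ := hT.connected.exists_adj_dist_eq_add_one hne
    refine (hmin q).not_gt (Finset.sum_lt_sum (fun v _ => ?_) ⟨v₀, Finset.mem_univ _, ?_⟩)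
    · obtain ⟨f, hf, hfd⟩ := hD v p
      by_cases hv : φ (RAAG.gen Γ v) p = p ∧ φ (RAAG.gen Γ v) q = q
      · have := hDle v q q hv.2
        rw [T.dist_self] at this
        omega
      · have h1 := RAAG.fixed_beyond_edge hT hφ hab hsep hell hpq hv₀ hf₀ hd₀ hv hf
        have h2 := hDle v q f hf
        omega
    · have := hDle v₀ q f₀ hf₀
      omega
  refine ⟨p, fun g => ?_⟩
  have hle : Subgroup.closure (Set.range (RAAG.gen Γ)) ≤
      (MulAction.stabilizer (Equiv.Perm W) p).comap φ := by
    rw [Subgroup.closure_le]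
    rintro _ ⟨v, rfl⟩
    exact hgen v
  rw [RAAG.closure_range_gen] at hle
  exact hle (Subgroup.mem_top g)

end Forward

/-- **Theorem A.** For a finite (nonempty) simplicial graph `Γ`, the right-angled Artin
group `A(Γ)` splits nontrivially over an abelian subgroup — i.e. admits an action
without inversions on a simplicial tree with no global fixed vertex and all edge
stabilizers abelian — if and only if `Γ` is disconnected, or `Γ` is complete, or
`Γ` contains a separating clique. -/
theorem raag_splits_over_abelian_iff {V : Type} [Finite V] [Nonempty V]
    (Γ : SimpleGraph V) :
    (∃ (W : Type) (T : SimpleGraph W) (φ : RAAG Γ →* Equiv.Perm W),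
        T.IsTree ∧ PreservesAdj T φ ∧ NoInversions T φ ∧
          AbelianEdgeStabilizers T φ ∧ ¬ HasGlobalFixedVertex φ) ↔
      (¬ Γ.Connected ∨ (∀ u v : V, u ≠ v → Γ.Adj u v) ∨
        ∃ K : Set V, SeparatingClique Γ K) := by
  constructor
  · rintro ⟨W, T, φ, hT, hφ, hinv, hab, hfix⟩
    by_contra! h
    exact hfix (RAAG.hasGlobalFixedVertex hT hφ hinv hab (by simpa using h.2.1)
      (by simpa using h.2.2))
  · rintro (h | h | ⟨K, hK⟩)
    · have : ∃ x y, ¬ Γ.Reachable x y := by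
        by_contra! hr
        exact h ⟨hr⟩
      obtain ⟨x, y, hxy⟩ := this
      refine exists_action_of_separatingClique (K := ∅)
        ⟨by simp, ⟨x, by simp⟩, ⟨y, by simp⟩, fun hr => hxy ?_⟩
      exact hr.map (SimpleGraph.Embedding.induce _).toHom
    · exact exists_action_of_complete h
    · exact exists_action_of_separatingClique hK
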